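/- For each j ≥ 1, the dyadic square function S_j^𝒟 satisfies the weak (1,1) bound sup_{λ>0} λ |{x : S_j^𝒟 f(x) > λ}| ≤ C(1+j)‖f‖_{L¹} for all f ∈ L¹(ℝ^d), where C depends only on d; in particular ‖S_j^𝒟‖_{L¹→L^{1,∞}} grows at most linearly in j. -/

import Mathlib

open MeasureTheory ENNReal Set

structure DyadicCube (d : ℕ) where
  j : ℤ
  m : Fin d → ℤ

namespace DyadicCube

variable {d : ℕ}

/-- side length `2^{-j}` of the dyadic cube. -/
noncomputable def side (Q : DyadicCube d) : ℝ := 2 ^ (-Q.j)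

/-- the dyadic cube `2^{-j}([0,1)^d + m)` as a subset of `ℝ^d`. -/
def toSet (Q : DyadicCube d) : Set (Fin d → ℝ) :=
  {x | ∀ i, (Q.m i : ℝ) * 2 ^ (-Q.j) ≤ x i ∧ x i < ((Q.m i : ℝ) + 1) * 2 ^ (-Q.j)}

/-- the concentric triple `3Q`. -/
def triple (Q : DyadicCube d) : Set (Fin d → ℝ) :=
  {x | ∀ i, ((Q.m i : ℝ) - 1) * 2 ^ (-Q.j) ≤ x i ∧ x i < ((Q.m i : ℝ) + 2) * 2 ^ (-Q.j)}

/-- the centre of the cube. -/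
noncomputable def center (Q : DyadicCube d) : Fin d → ℝ :=
  fun i => ((Q.m i : ℝ) + 1 / 2) * 2 ^ (-Q.j)

/-- the `k`-fold dyadic ancestor `Q^{(k)}`. -/
def ancestor (k : ℕ) (Q : DyadicCube d) : DyadicCube d :=
  ⟨Q.j - k, fun i => Int.fdiv (Q.m i) (2 ^ k)⟩

/-- the `k`-grandchildren `ch_k(Q)`. -/
def children (k : ℕ) (Q : DyadicCube d) : Set (DyadicCube d) :=
  {P | P.j = Q.j + k ∧ P.toSet ⊆ Q.toSet}

/-- distance between two sets in the `ℓ^∞` metric of `ℝ^d`. -/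
noncomputable def sdist (A B : Set (Fin d → ℝ)) : ℝ :=
  (⨅ a ∈ A, EMetric.infEdist a B).toReal

/-- average `⟨f⟩_A` of `f` over `A`. -/
noncomputable def avg (f : (Fin d → ℝ) → ℝ) (A : Set (Fin d → ℝ)) : ℝ :=
  (volume A).toReal⁻¹ * ∫ x in A, f x

/-- average `⟨|f|⟩_A`. -/
noncomputable def avgAbs (f : (Fin d → ℝ) → ℝ) (A : Set (Fin d → ℝ)) : ℝ :=
  avg (fun x => |f x|) A

/-- `Q` is `r`-good with parameter `γ`. -/
def IsGood (r : ℕ) (γ : ℝ) (Q : DyadicCube d) : Prop :=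
  ∀ P : DyadicCube d, 2 ^ r * Q.side ≤ P.side →
    Q.side ^ γ * P.side ^ (1 - γ) < sdist Q.toSet (frontier P.toSet)

/-- martingale (Haar) difference `Δ_Q f`. -/
noncomputable def mdiff (f : (Fin d → ℝ) → ℝ) (Q : DyadicCube d) (x : Fin d → ℝ) : ℝ :=
  ∑' J : {J : DyadicCube d // J ∈ children 1 Q},
    Set.indicator J.1.toSet (fun _ => avg f J.1.toSet - avg f Q.toSet) x

/-- `Σ_ε ⟨f, h_Q^ε⟩² = ‖Δ_Q f‖_{L²}²`, the total squared Haar coefficient on `Q`. -/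
noncomputable def haarSq (f : (Fin d → ℝ) → ℝ) (P : DyadicCube d) : ℝ :=
  ∫ x in P.toSet, (mdiff f P x) ^ 2

end DyadicCube

open DyadicCube

variable {d : ℕ}

/-- the square `(S_j^𝒟 f(x))²` of the dyadic square function (the implicit sum of squared Haar
coefficients over signs is `haarSq`). -/
noncomputable def sqFnD (j : ℕ) (f : (Fin d → ℝ) → ℝ) (x : Fin d → ℝ) : ℝ≥0∞ :=
  ∑' Q : DyadicCube d,
    ∑' P : {P : DyadicCube d // P.j = Q.j + j ∧ P.toSet ⊆ Q.toSet},
      ENNReal.ofReal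
        (Set.indicator P.1.toSet (fun _ => haarSq f P.1 / (volume P.1.toSet).toReal) x)

/-- the square `(S_j^{3𝒟} f(x))²` of the enlarged square function. -/
noncomputable def sqFn3 (j : ℕ) (f : (Fin d → ℝ) → ℝ) (x : Fin d → ℝ) : ℝ≥0∞ :=
  ∑' Q : DyadicCube d,
    ∑' P : {P : DyadicCube d // P.j = Q.j + j ∧ P.toSet ⊆ Q.triple},
      ENNReal.ofReal
        (Set.indicator P.1.toSet (fun _ => haarSq f P.1 / (volume P.1.toSet).toReal) x)

namespace DyadicCube

theorem ext_level {P Q : DyadicCube d} (hj : P.j = Q.j) (hm : P.m = Q.m) : P = Q := by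
  cases P; cases Q; simp_all

/-- The dyadic cube of side `2^{-n}` containing the point `x`. -/
noncomputable def cubeAt (n : ℤ) (x : Fin d → ℝ) : DyadicCube d :=
  ⟨n, fun i => ⌊x i * 2 ^ n⌋⟩

theorem mem_toSet_iff {Q : DyadicCube d} {x : Fin d → ℝ} :
    x ∈ Q.toSet ↔ cubeAt Q.j x = Q := by
  have h2 : (0 : ℝ) < 2 ^ Q.j := by positivity
  have key : ∀ i, ((Q.m i : ℝ) * 2 ^ (-Q.j) ≤ x i ∧ x i < ((Q.m i : ℝ) + 1) * 2 ^ (-Q.j)) ↔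
      ⌊x i * 2 ^ Q.j⌋ = Q.m i := by
    intro i
    rw [Int.floor_eq_iff, zpow_neg, ← div_eq_mul_inv, ← div_eq_mul_inv, div_le_iff₀ h2,
      lt_div_iff₀ h2]
  simp only [toSet, mem_ofPred_eq, key]
  constructor
  · intro h
    exact ext_level rfl (funext h)
  · intro h i
    exact congrFun (congrArg DyadicCube.m h) i

theorem mem_cubeAt (n : ℤ) (x : Fin d → ℝ) : x ∈ (cubeAt n x).toSet :=
  mem_toSet_iff.2 rfl

/-- The lower corner of a dyadic cube. -/
noncomputable def corner (Q : DyadicCube d) : Fin d → ℝ :=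
  fun i => (Q.m i : ℝ) * 2 ^ (-Q.j)

theorem corner_mem (Q : DyadicCube d) : Q.corner ∈ Q.toSet := by
  intro i
  have h2 : (0 : ℝ) < 2 ^ (-Q.j) := by positivity
  refine ⟨le_rfl, ?_⟩
  simp only [corner]
  nlinarith

theorem toSet_disjoint {P Q : DyadicCube d} (hj : P.j = Q.j) (hne : P ≠ Q) :
    Disjoint P.toSet Q.toSet := by
  rw [Set.disjoint_left]
  intro x hP hQ
  rw [mem_toSet_iff] at hP hQ
  exact hne (hP.symm.trans (hj ▸ hQ))

theorem toSet_eq_pi (Q : DyadicCube d) : Q.toSet = Set.pi univ fun i =>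
    Ico ((Q.m i : ℝ) * 2 ^ (-Q.j)) (((Q.m i : ℝ) + 1) * 2 ^ (-Q.j)) := by
  ext x
  simp [toSet]

theorem measurableSet_toSet (Q : DyadicCube d) : MeasurableSet Q.toSet := by
  rw [toSet_eq_pi]
  exact MeasurableSet.univ_pi fun i => measurableSet_Ico

theorem volume_toSet (Q : DyadicCube d) :
    volume Q.toSet = ENNReal.ofReal (((2 : ℝ) ^ (-Q.j)) ^ d) := by
  rw [toSet_eq_pi, Real.volume_pi_Ico, ENNReal.ofReal_pow (by positivity)]
  have : ∀ i, ((Q.m i : ℝ) + 1) * 2 ^ (-Q.j) - (Q.m i : ℝ) * 2 ^ (-Q.j) = 2 ^ (-Q.j) :=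
    fun i => by ring
  simp only [this, Finset.prod_const, Finset.card_univ, Fintype.card_fin]

/-- The volume of a dyadic cube as a real number. -/
noncomputable def vol (Q : DyadicCube d) : ℝ := (volume Q.toSet).toReal

theorem vol_eq (Q : DyadicCube d) : Q.vol = ((2 : ℝ) ^ (-Q.j)) ^ d := by
  rw [vol, volume_toSet, ENNReal.toReal_ofReal (by positivity)]

theorem vol_pos (Q : DyadicCube d) : 0 < Q.vol := by
  rw [vol_eq]; positivity

theorem ofReal_vol (Q : DyadicCube d) : ENNReal.ofReal Q.vol = volume Q.toSet := by
  rw [vol_eq, volume_toSet]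

theorem volume_toSet_ne_top (Q : DyadicCube d) : volume Q.toSet ≠ ∞ := by
  rw [volume_toSet]; exact ENNReal.ofReal_ne_top

open Classical in
/-- The finite set of dyadic children of a cube. -/
noncomputable def kids (P : DyadicCube d) : Finset (DyadicCube d) :=
  (Fintype.piFinset fun i => ({2 * P.m i, 2 * P.m i + 1} : Finset ℤ)).image
    fun m => ⟨P.j + 1, m⟩

theorem mem_kids {P J : DyadicCube d} :
    J ∈ P.kids ↔ J.j = P.j + 1 ∧ ∀ i, J.m i = 2 * P.m i ∨ J.m i = 2 * P.m i + 1 := by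
  simp only [kids, Finset.mem_image, Fintype.mem_piFinset, Finset.mem_insert,
    Finset.mem_singleton]
  constructor
  · rintro ⟨m, hm, rfl⟩
    exact ⟨rfl, hm⟩
  · rintro ⟨hj, hm⟩
    exact ⟨J.m, hm, ext_level hj.symm rfl⟩

theorem cubeAt_succ_mem_kids (n : ℤ) (x : Fin d → ℝ) : cubeAt (n + 1) x ∈ (cubeAt n x).kids := by
  rw [mem_kids]
  refine ⟨rfl, fun i => ?_⟩
  simp only [cubeAt]
  have h : x i * 2 ^ (n + 1) = 2 * (x i * 2 ^ n) := by
    rw [zpow_add_one₀ (by norm_num)]; ring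
  rw [h]
  have h1 := Int.floor_le (x i * 2 ^ n)
  have h2 := Int.lt_floor_add_one (x i * 2 ^ n)
  have h3 : 2 * ⌊x i * 2 ^ n⌋ ≤ ⌊2 * (x i * 2 ^ n)⌋ := by
    rw [Int.le_floor]; push_cast; linarith
  have h4 : ⌊2 * (x i * 2 ^ n)⌋ < 2 * ⌊x i * 2 ^ n⌋ + 2 := by
    rw [Int.floor_lt]; push_cast; linarith
  omega

theorem eq_of_mem_kids {J P P' : DyadicCube d} (h : J ∈ P.kids) (h' : J ∈ P'.kids) : P = P' := by
  rw [mem_kids] at h h'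
  refine ext_level (by omega) (funext fun i => ?_)
  have := h.2 i
  have := h'.2 i
  omega

theorem mem_kids_iff_subset {P J : DyadicCube d} :
    J ∈ P.kids ↔ J.j = P.j + 1 ∧ J.toSet ⊆ P.toSet := by
  constructor
  · intro h
    refine ⟨(mem_kids.1 h).1, fun x hx => ?_⟩
    have hj := (mem_kids.1 h).1
    rw [mem_toSet_iff] at hx ⊢
    have h' := cubeAt_succ_mem_kids P.j x
    rw [← hj, hx] at h'
    exact eq_of_mem_kids h' h
  · rintro ⟨hj, hs⟩
    have h1 := hs J.corner_mem
    have h2 := J.corner_mem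
    rw [mem_toSet_iff] at h1 h2
    have h' := cubeAt_succ_mem_kids P.j J.corner
    rwa [← hj, h2, h1] at h'

theorem children_one (P : DyadicCube d) : children 1 P = ↑P.kids := by
  ext J
  simp [children, mem_kids_iff_subset]

theorem biUnion_kids (P : DyadicCube d) : ⋃ J ∈ P.kids, J.toSet = P.toSet := by
  ext x
  simp only [mem_iUnion, exists_prop]
  constructor
  · rintro ⟨J, hJ, hx⟩
    exact (mem_kids_iff_subset.1 hJ).2 hx
  · intro hx
    refine ⟨cubeAt (P.j + 1) x, ?_, mem_cubeAt _ _⟩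
    have := cubeAt_succ_mem_kids P.j x
    rwa [mem_toSet_iff.1 hx] at this

theorem pairwise_disjoint_kids (P : DyadicCube d) :
    (↑P.kids : Set (DyadicCube d)).Pairwise (Function.onFun Disjoint toSet) := by
  intro J hJ K hK hne
  refine toSet_disjoint ?_ hne
  rw [(mem_kids.1 hJ).1, (mem_kids.1 hK).1]

theorem vol_kid {P J : DyadicCube d} (h : J ∈ P.kids) : P.vol = 2 ^ d * J.vol := by
  rw [vol_eq, vol_eq, (mem_kids.1 h).1, ← mul_pow]
  congr 1
  rw [neg_add, zpow_add₀ (by norm_num)]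
  norm_num
  ring

theorem integral_eq_sum_kids {g : (Fin d → ℝ) → ℝ} (P : DyadicCube d)
    (hg : ∀ J ∈ P.kids, IntegrableOn g J.toSet) :
    ∫ x in P.toSet, g x = ∑ J ∈ P.kids, ∫ x in J.toSet, g x := by
  rw [← biUnion_kids P, integral_biUnion_finset _ (fun J _ => J.measurableSet_toSet)
    P.pairwise_disjoint_kids hg]

theorem mdiff_of_mem (f : (Fin d → ℝ) → ℝ) {P J : DyadicCube d} (hJ : J ∈ P.kids)
    {x : Fin d → ℝ} (hx : x ∈ J.toSet) :
    mdiff f P x = avg f J.toSet - avg f P.toSet := by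
  have hJ' : J ∈ children 1 P := by rw [children_one]; exact hJ
  rw [mdiff, tsum_eq_single ⟨J, hJ'⟩]
  · exact indicator_of_mem hx _
  · rintro ⟨K, hK⟩ hne
    rw [children_one] at hK
    refine indicator_of_notMem (fun hxK => ?_) _
    have hKJ : K ≠ J := fun h => hne (Subtype.ext h)
    exact (Set.disjoint_left.1 (P.pairwise_disjoint_kids hK hJ hKJ)) hxK hx

theorem haarSq_eq_sum (f : (Fin d → ℝ) → ℝ) (P : DyadicCube d) :
    haarSq f P = ∑ J ∈ P.kids, J.vol * (avg f J.toSet - avg f P.toSet) ^ 2 := by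
  have hcongr : ∀ J ∈ P.kids, EqOn (fun x => mdiff f P x ^ 2)
      (fun _ => (avg f J.toSet - avg f P.toSet) ^ 2) J.toSet := by
    intro J hJ x hx
    simp only [mdiff_of_mem f hJ hx]
  rw [haarSq, integral_eq_sum_kids]
  · refine Finset.sum_congr rfl fun J hJ => ?_
    rw [setIntegral_congr_fun J.measurableSet_toSet (hcongr J hJ), setIntegral_const]
    rfl
  · intro J hJ
    rw [integrableOn_congr_fun (hcongr J hJ) J.measurableSet_toSet]
    exact integrableOn_const J.volume_toSet_ne_top

theorem haarSq_nonneg (f : (Fin d → ℝ) → ℝ) (P : DyadicCube d) : 0 ≤ haarSq f P :=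
  integral_nonneg fun _ => sq_nonneg _

theorem vol_mul_avg (f : (Fin d → ℝ) → ℝ) (P : DyadicCube d) :
    P.vol * avg f P.toSet = ∫ x in P.toSet, f x :=
  mul_inv_cancel_left₀ P.vol_pos.ne' _

theorem sum_vol_kids (P : DyadicCube d) : ∑ J ∈ P.kids, J.vol = P.vol := by
  have h := integral_eq_sum_kids (g := fun _ => (1 : ℝ)) P
    (fun J _ => integrableOn_const J.volume_toSet_ne_top)
  simpa [Measure.real, vol] using h.symm

theorem vol_mul_avg_sq_add_haarSq {f : (Fin d → ℝ) → ℝ} (hf : Integrable f) (P : DyadicCube d) :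
    P.vol * avg f P.toSet ^ 2 + haarSq f P = ∑ J ∈ P.kids, J.vol * avg f J.toSet ^ 2 := by
  have h1 : ∑ J ∈ P.kids, J.vol * avg f J.toSet = P.vol * avg f P.toSet := by
    simp only [vol_mul_avg]
    exact (integral_eq_sum_kids P fun J _ => hf.integrableOn).symm
  have h2 : haarSq f P = ∑ J ∈ P.kids, J.vol * avg f J.toSet ^ 2
      - 2 * avg f P.toSet * ∑ J ∈ P.kids, J.vol * avg f J.toSet
      + avg f P.toSet ^ 2 * ∑ J ∈ P.kids, J.vol := by
    rw [haarSq_eq_sum, Finset.mul_sum, Finset.mul_sum, ← Finset.sum_sub_distrib,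
      ← Finset.sum_add_distrib]
    exact Finset.sum_congr rfl fun J _ => by ring
  rw [h2, h1, sum_vol_kids]
  ring

theorem vol_mul_avg_sq_le {f : (Fin d → ℝ) → ℝ} {c : ℝ} {P : DyadicCube d}
    (h : ∫ x in P.toSet, |f x| ≤ c * P.vol) :
    P.vol * avg f P.toSet ^ 2 ≤ c * ∫ x in P.toSet, |f x| := by
  have h0 : 0 ≤ ∫ x in P.toSet, |f x| := integral_nonneg fun _ => abs_nonneg _
  have h1 : |∫ x in P.toSet, f x| ≤ ∫ x in P.toSet, |f x| := abs_integral_le_integral_abs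
  have h2 : P.vol * avg f P.toSet ^ 2 = (∫ x in P.toSet, f x) ^ 2 / P.vol := by
    rw [← vol_mul_avg, eq_div_iff P.vol_pos.ne']; ring
  rw [h2, div_le_iff₀ P.vol_pos, ← sq_abs]
  nlinarith [abs_nonneg (∫ x in P.toSet, f x)]

/-- The contribution of the scale `2^{-n}` to the square function. -/
noncomputable def sqTerm (f : (Fin d → ℝ) → ℝ) (n : ℤ) (x : Fin d → ℝ) : ℝ≥0∞ :=
  ENNReal.ofReal (haarSq f (cubeAt n x) / (cubeAt n x).vol)

theorem measurable_sqTerm (f : (Fin d → ℝ) → ℝ) (n : ℤ) : Measurable (sqTerm f n) := by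
  have h : Measurable fun x : Fin d → ℝ => fun i => ⌊x i * 2 ^ n⌋ :=
    measurable_pi_lambda _ fun i => ((measurable_pi_apply i).mul_const _).floor
  exact (Measurable.of_discrete (f := fun m : Fin d → ℤ =>
    ENNReal.ofReal (haarSq f ⟨n, m⟩ / vol ⟨n, m⟩))).comp h

/-- The square function restricted to the `k` scales starting from `2^{-n}`. -/
noncomputable def sqPartial (f : (Fin d → ℝ) → ℝ) (k : ℕ) (n : ℤ) (x : Fin d → ℝ) : ℝ≥0∞ :=
  ∑ i ∈ Finset.range k, sqTerm f (n + i) x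

theorem measurable_sqPartial (f : (Fin d → ℝ) → ℝ) (k : ℕ) (n : ℤ) :
    Measurable (sqPartial f k n) :=
  Finset.measurable_sum _ fun i _ => measurable_sqTerm f (n + i)

theorem sqPartial_succ (f : (Fin d → ℝ) → ℝ) (k : ℕ) (n : ℤ) (x : Fin d → ℝ) :
    sqPartial f (k + 1) n x = sqTerm f n x + sqPartial f k (n + 1) x := by
  rw [sqPartial, Finset.sum_range_succ', add_comm]
  simp only [sqPartial, Nat.cast_add, Nat.cast_one, Nat.cast_zero, add_zero]
  congr 1
  exact Finset.sum_congr rfl fun i _ => by rw [add_assoc, add_comm (1 : ℤ)]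

theorem lintegral_sqTerm_le (f : (Fin d → ℝ) → ℝ) {P : DyadicCube d} {A : Set (Fin d → ℝ)}
    (hA : A ⊆ P.toSet) : ∫⁻ x in A, sqTerm f P.j x ≤ ENNReal.ofReal (haarSq f P) := by
  calc ∫⁻ x in A, sqTerm f P.j x ≤ ∫⁻ x in P.toSet, sqTerm f P.j x := lintegral_mono_set hA
    _ = ∫⁻ _ in P.toSet, ENNReal.ofReal (haarSq f P / P.vol) := by
        refine setLIntegral_congr_fun P.measurableSet_toSet fun x hx => ?_
        simp only [sqTerm, mem_toSet_iff.1 hx]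
    _ = ENNReal.ofReal (haarSq f P) := by
        rw [setLIntegral_const, ← ofReal_vol, ← ENNReal.ofReal_mul
          (div_nonneg (haarSq_nonneg f P) P.vol_pos.le), div_mul_cancel₀ _ P.vol_pos.ne']

/-- Calderón–Zygmund stopping on a single cube: outside a small exceptional set, the truncated
square function is square integrable with the expected bound. -/
theorem exists_exceptional_set {f : (Fin d → ℝ) → ℝ} (hf : Integrable f) {lam : ℝ}
    (hlam : 0 < lam) (k : ℕ) (P : DyadicCube d)
    (hP : ∫ x in P.toSet, |f x| ≤ 2 ^ d * lam * P.vol) :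
    ∃ E : Set (Fin d → ℝ),
      ENNReal.ofReal lam * volume E ≤ ENNReal.ofReal (∫ x in P.toSet, |f x|) ∧
      ENNReal.ofReal (P.vol * avg f P.toSet ^ 2) + ∫⁻ x in P.toSet \ E, sqPartial f k P.j x ≤
        ENNReal.ofReal (2 ^ d * lam * ∫ x in P.toSet, |f x|) := by
  induction k generalizing P with
  | zero =>
    refine ⟨∅, by simp, ?_⟩
    simp only [sqPartial, Finset.range_zero, Finset.sum_empty, lintegral_zero, add_zero]
    exact ENNReal.ofReal_le_ofReal (vol_mul_avg_sq_le hP)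
  | succ k ih =>
    rcases lt_or_ge (lam * P.vol) (∫ x in P.toSet, |f x|) with hbad | hgood
    · refine ⟨P.toSet, ?_, ?_⟩
      · rw [← ofReal_vol, ← ENNReal.ofReal_mul hlam.le]
        exact ENNReal.ofReal_le_ofReal hbad.le
      · simp only [sdiff_self, Measure.restrict_empty, lintegral_zero_measure, add_zero]
        exact ENNReal.ofReal_le_ofReal (vol_mul_avg_sq_le hP)
    · have habs : ∫ x in P.toSet, |f x| = ∑ J ∈ P.kids, ∫ x in J.toSet, |f x| :=
        integral_eq_sum_kids P fun J _ => hf.abs.integrableOn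
      have hpos : ∀ J : DyadicCube d, 0 ≤ ∫ x in J.toSet, |f x| :=
        fun J => integral_nonneg fun _ => abs_nonneg _
      have hkid : ∀ J ∈ P.kids, ∫ x in J.toSet, |f x| ≤ 2 ^ d * lam * J.vol := by
        intro J hJ
        calc ∫ x in J.toSet, |f x| ≤ ∫ x in P.toSet, |f x| := by
              rw [habs]
              exact Finset.single_le_sum (f := fun J : DyadicCube d => ∫ x in J.toSet, |f x|)
                (fun K _ => hpos K) hJ
          _ ≤ lam * P.vol := hgood
          _ = 2 ^ d * lam * J.vol := by rw [vol_kid hJ]; ring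
      have hex := fun J : P.kids => ih J.1 (hkid J.1 J.2)
      choose E hE1 hE2 using hex
      refine ⟨⋃ J, E J, ?_, ?_⟩
      · calc ENNReal.ofReal lam * volume (⋃ J, E J)
            ≤ ENNReal.ofReal lam * ∑ J, volume (E J) := by
              gcongr; exact measure_iUnion_fintype_le _ _
          _ = ∑ J, ENNReal.ofReal lam * volume (E J) := Finset.mul_sum _ _ _
          _ ≤ ∑ J : P.kids, ENNReal.ofReal (∫ x in J.1.toSet, |f x|) :=
              Finset.sum_le_sum fun J _ => hE1 J
          _ = ENNReal.ofReal (∫ x in P.toSet, |f x|) := by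
              rw [habs, ENNReal.ofReal_sum_of_nonneg fun J _ => hpos J,
                ← Finset.sum_coe_sort P.kids]
      · have hsub : P.toSet \ ⋃ J, E J ⊆ ⋃ J : P.kids, J.1.toSet \ E J := by
          rintro x ⟨hx, hxE⟩
          rw [← biUnion_kids] at hx
          simp only [mem_iUnion, exists_prop] at hx
          obtain ⟨J, hJ, hxJ⟩ := hx
          exact mem_iUnion.2 ⟨⟨J, hJ⟩, hxJ, fun h => hxE (mem_iUnion.2 ⟨_, h⟩)⟩
        have htail : ∫⁻ x in P.toSet \ ⋃ J, E J, sqPartial f k (P.j + 1) x ≤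
            ∑ J : P.kids, ∫⁻ x in J.1.toSet \ E J, sqPartial f k J.1.j x := by
          refine (lintegral_mono_set hsub).trans ((lintegral_iUnion_le _ _).trans_eq ?_)
          rw [tsum_fintype]
          exact Finset.sum_congr rfl fun J _ => by rw [(mem_kids.1 J.2).1]
        have hsq : ∀ J : DyadicCube d, 0 ≤ J.vol * avg f J.toSet ^ 2 :=
          fun J => mul_nonneg J.vol_pos.le (sq_nonneg _)
        have hmeas := measurable_sqTerm f P.j
        calc ENNReal.ofReal (P.vol * avg f P.toSet ^ 2) +
              ∫⁻ x in P.toSet \ ⋃ J, E J, sqPartial f (k + 1) P.j x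
            = ENNReal.ofReal (P.vol * avg f P.toSet ^ 2) +
              ((∫⁻ x in P.toSet \ ⋃ J, E J, sqTerm f P.j x) +
              ∫⁻ x in P.toSet \ ⋃ J, E J, sqPartial f k (P.j + 1) x) := by
              simp only [sqPartial_succ]
              rw [lintegral_add_left hmeas]
          _ ≤ ENNReal.ofReal (P.vol * avg f P.toSet ^ 2) + (ENNReal.ofReal (haarSq f P) +
              ∑ J : P.kids, ∫⁻ x in J.1.toSet \ E J, sqPartial f k J.1.j x) := by
              gcongr
              exact lintegral_sqTerm_le f sdiff_subset
          _ = ∑ J : P.kids, (ENNReal.ofReal (J.1.vol * avg f J.1.toSet ^ 2) +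
              ∫⁻ x in J.1.toSet \ E J, sqPartial f k J.1.j x) := by
              rw [← add_assoc, ← ENNReal.ofReal_add (hsq P) (haarSq_nonneg f P),
                vol_mul_avg_sq_add_haarSq hf, ENNReal.ofReal_sum_of_nonneg fun J _ => hsq J,
                ← Finset.sum_coe_sort P.kids, Finset.sum_add_distrib]
          _ ≤ ∑ J : P.kids, ENNReal.ofReal (2 ^ d * lam * ∫ x in J.1.toSet, |f x|) :=
              Finset.sum_le_sum fun J _ => hE2 J
          _ = ENNReal.ofReal (2 ^ d * lam * ∫ x in P.toSet, |f x|) := by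
              rw [habs, Finset.mul_sum, ENNReal.ofReal_sum_of_nonneg fun J _ =>
                mul_nonneg (by positivity) (hpos J), ← Finset.sum_coe_sort P.kids]

theorem weak_type_on_cube {f : (Fin d → ℝ) → ℝ} (hf : Integrable f) {lam : ℝ}
    (hlam : 0 < lam) (k : ℕ) (P : DyadicCube d) :
    ENNReal.ofReal lam *
        volume ({x | ENNReal.ofReal (lam ^ 2) ≤ sqPartial f k P.j x} ∩ P.toSet) ≤
      ENNReal.ofReal (1 + 2 ^ d) * ∫⁻ x in P.toSet, ‖f x‖ₑ := by
  have hI : ∫⁻ x in P.toSet, ‖f x‖ₑ = ENNReal.ofReal (∫ x in P.toSet, |f x|) :=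
    (ofReal_integral_norm_eq_lintegral_enorm hf.integrableOn).symm
  have hl0 : ENNReal.ofReal lam ≠ 0 := by simpa using hlam
  rw [hI, ENNReal.ofReal_add zero_le_one (by positivity), ENNReal.ofReal_one, add_mul, one_mul]
  set S := {x | ENNReal.ofReal (lam ^ 2) ≤ sqPartial f k P.j x}
  rcases le_or_gt (∫ x in P.toSet, |f x|) (2 ^ d * lam * P.vol) with hP | hP
  · obtain ⟨E, hE1, hE2⟩ := exists_exceptional_set hf hlam k P hP
    have hsub : S ∩ P.toSet ⊆ E ∪ S ∩ (P.toSet \ E) := by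
      rintro x ⟨hxS, hxP⟩
      by_cases hxE : x ∈ E
      · exact Or.inl hxE
      · exact Or.inr ⟨hxS, hxP, hxE⟩
    have hSm : MeasurableSet S := measurableSet_le measurable_const (measurable_sqPartial f k P.j)
    have hcheb : ENNReal.ofReal lam * volume (S ∩ (P.toSet \ E)) ≤
        ENNReal.ofReal (2 ^ d) * ENNReal.ofReal (∫ x in P.toSet, |f x|) := by
      have h := (mul_meas_ge_le_lintegral (μ := volume.restrict (P.toSet \ E))
        (measurable_sqPartial f k P.j) (ENNReal.ofReal (lam ^ 2))).trans
          ((le_add_self).trans hE2)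
      rw [Measure.restrict_apply hSm, sq, ENNReal.ofReal_mul hlam.le, mul_comm (2 ^ d) lam,
        mul_assoc, mul_assoc, ENNReal.ofReal_mul hlam.le,
        ENNReal.mul_le_mul_iff_right hl0 ENNReal.ofReal_ne_top,
        ENNReal.ofReal_mul (by positivity)] at h
      exact h
    calc ENNReal.ofReal lam * volume (S ∩ P.toSet)
        ≤ ENNReal.ofReal lam * (volume E + volume (S ∩ (P.toSet \ E))) := by
          gcongr
          exact (measure_mono hsub).trans (measure_union_le _ _)
      _ ≤ _ := by
          rw [mul_add]
          exact add_le_add hE1 hcheb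
  · calc ENNReal.ofReal lam * volume (S ∩ P.toSet)
        ≤ ENNReal.ofReal lam * ENNReal.ofReal P.vol := by
          rw [ofReal_vol]
          gcongr
          exact inter_subset_right
      _ = ENNReal.ofReal (lam * P.vol) := (ENNReal.ofReal_mul hlam.le).symm
      _ ≤ ENNReal.ofReal (∫ x in P.toSet, |f x|) := by
          refine ENNReal.ofReal_le_ofReal (le_trans ?_ hP.le)
          rw [mul_assoc]
          exact le_mul_of_one_le_left (mul_pos hlam P.vol_pos).le (one_le_pow₀ one_le_two)
      _ ≤ _ := le_self_add

theorem weak_type_sqPartial {f : (Fin d → ℝ) → ℝ} (hf : Integrable f) {lam : ℝ}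
    (hlam : 0 < lam) (k : ℕ) (n : ℤ) :
    ENNReal.ofReal lam * volume {x | ENNReal.ofReal (lam ^ 2) ≤ sqPartial f k n x} ≤
      ENNReal.ofReal (1 + 2 ^ d) * ∫⁻ x, ‖f x‖ₑ := by
  let Q : (Fin d → ℤ) → DyadicCube d := fun m => ⟨n, m⟩
  have hcover : ⋃ m, (Q m).toSet = univ := by
    refine eq_univ_of_forall fun x => mem_iUnion.2 ⟨(cubeAt n x).m, mem_cubeAt n x⟩
  have hdisj : Pairwise (Function.onFun Disjoint fun m => (Q m).toSet) :=
    fun m m' hne => toSet_disjoint rfl fun h => hne (congrArg DyadicCube.m h)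
  have hint : ∫⁻ x, ‖f x‖ₑ = ∑' m, ∫⁻ x in (Q m).toSet, ‖f x‖ₑ := by
    rw [← lintegral_iUnion (fun m => (Q m).measurableSet_toSet) hdisj, hcover,
      Measure.restrict_univ]
  set S := {x | ENNReal.ofReal (lam ^ 2) ≤ sqPartial f k n x}
  calc ENNReal.ofReal lam * volume S
      ≤ ENNReal.ofReal lam * ∑' m, volume (S ∩ (Q m).toSet) := by
        gcongr
        have hS : S = ⋃ m, S ∩ (Q m).toSet := by rw [← inter_iUnion, hcover, inter_univ]
        exact (measure_mono hS.subset).trans (measure_iUnion_le _)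
    _ = ∑' m, ENNReal.ofReal lam * volume (S ∩ (Q m).toSet) := ENNReal.tsum_mul_left.symm
    _ ≤ ∑' m, ENNReal.ofReal (1 + 2 ^ d) * ∫⁻ x in (Q m).toSet, ‖f x‖ₑ :=
        ENNReal.tsum_le_tsum fun m => weak_type_on_cube hf hlam k (Q m)
    _ = ENNReal.ofReal (1 + 2 ^ d) * ∫⁻ x, ‖f x‖ₑ := by rw [ENNReal.tsum_mul_left, hint]

/-- The square function is dominated by the sum of its contributions at all scales: every cube
has only one `j`-fold dyadic ancestor. -/
theorem sqFnD_le_tsum_sqTerm (j : ℕ) (f : (Fin d → ℝ) → ℝ) (x : Fin d → ℝ) :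
    sqFnD j f x ≤ ∑' n : ℤ, sqTerm f n x := by
  let F : DyadicCube d → ℝ≥0∞ := fun P => ENNReal.ofReal
    (Set.indicator P.toSet (fun _ => haarSq f P / (volume P.toSet).toReal) x)
  have hinj : Function.Injective fun s : (Σ Q : DyadicCube d,
      {P : DyadicCube d // P.j = Q.j + j ∧ P.toSet ⊆ Q.toSet}) => s.2.1 := by
    rintro ⟨Q, P, hP⟩ ⟨Q', P', hP'⟩ (rfl : P = P')
    have hj : Q.j = Q'.j := by omega
    have h1 := mem_toSet_iff.1 (hP.2 P.corner_mem)
    have h2 := mem_toSet_iff.1 (hP'.2 P.corner_mem)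
    obtain rfl : Q = Q' := by rw [← h1, ← h2, hj]
    rfl
  have hinj' : Function.Injective fun n : ℤ => cubeAt n x :=
    fun n n' h => congrArg DyadicCube.j h
  have hsupp : Function.support F ⊆ range fun n : ℤ => cubeAt n x := by
    intro P hP
    refine ⟨P.j, mem_toSet_iff.1 ?_⟩
    by_contra hx
    exact hP (by simp [F, indicator_of_notMem hx])
  calc sqFnD j f x = ∑' s : (Σ Q : DyadicCube d,
        {P : DyadicCube d // P.j = Q.j + j ∧ P.toSet ⊆ Q.toSet}), F s.2.1 := by
        rw [ENNReal.tsum_sigma']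
        rfl
    _ ≤ ∑' P, F P := ENNReal.tsum_comp_le_tsum_of_injective hinj F
    _ = ∑' n : ℤ, F (cubeAt n x) := (hinj'.tsum_eq hsupp).symm
    _ = ∑' n : ℤ, sqTerm f n x := by
        refine tsum_congr fun n => ?_
        simp only [F, indicator_of_mem (mem_cubeAt n x)]
        rfl

theorem sqPartial_eq_sum_Ico (f : (Fin d → ℝ) → ℝ) (N : ℕ) (x : Fin d → ℝ) :
    sqPartial f (2 * N) (-N) x = ∑ n ∈ Finset.Ico (-N : ℤ) N, sqTerm f n x := by
  refine Finset.sum_nbij (fun i : ℕ => -(N : ℤ) + i) ?_ ?_ ?_ ?_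
  · intro i hi
    simp only [Finset.mem_range] at hi
    simp only [Finset.mem_Ico]
    omega
  · intro a _ b _ h
    simpa using h
  · intro n hn
    simp only [Finset.coe_Ico, Set.mem_Ico] at hn
    refine ⟨(n + N).toNat, ?_, ?_⟩
    · simp only [Finset.coe_range, Set.mem_Iio]
      omega
    · simp only
      omega
  · intro i _
    rfl

theorem superlevel_tsum_sqTerm_subset (f : (Fin d → ℝ) → ℝ) (c : ℝ≥0∞) :
    {x | c < ∑' n : ℤ, sqTerm f n x} ⊆
      ⋃ N : ℕ, {x | c ≤ sqPartial f (2 * N) (-N) x} := by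
  intro x (hx : c < _)
  rw [ENNReal.tsum_eq_iSup_sum, lt_iSup_iff] at hx
  obtain ⟨s, hs⟩ := hx
  refine mem_iUnion.2 ⟨s.sup Int.natAbs + 1, hs.le.trans ?_⟩
  rw [sqPartial_eq_sum_Ico]
  refine Finset.sum_le_sum_of_subset fun n hn => ?_
  have := Finset.le_sup (f := Int.natAbs) hn
  rw [Finset.mem_Ico]
  omega

theorem monotone_superlevel_sqPartial (f : (Fin d → ℝ) → ℝ) (c : ℝ≥0∞) :
    Monotone fun N : ℕ => {x | c ≤ sqPartial f (2 * N) (-N) x} := by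
  intro M N hMN x (hx : c ≤ _)
  refine le_trans hx ?_
  rw [sqPartial_eq_sum_Ico, sqPartial_eq_sum_Ico]
  refine Finset.sum_le_sum_of_subset (Finset.Ico_subset_Ico ?_ ?_) <;> omega

end DyadicCube

/-- Weak `(1,1)` bound for the dyadic square function: there is `C = C(d)` with
`λ |{S_j^𝒟 f > λ}| ≤ C (1+j) ‖f‖_{L¹}` for all `j ≥ 1`, `f ∈ L¹`, `λ > 0`. -/
theorem weak_one_one_square_function (d : ℕ) :
    ∃ C > 0, ∀ j : ℕ, 1 ≤ j → ∀ f : (Fin d → ℝ) → ℝ, Integrable f →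
      ∀ lam : ℝ, 0 < lam →
        ENNReal.ofReal lam *
            volume {x | ENNReal.ofReal lam < sqFnD j f x ^ ((1 : ℝ) / 2)} ≤
          ENNReal.ofReal (C * (1 + j) * ∫ x, |f x|) := by
  refine ⟨1 + 2 ^ d, by positivity, fun j _ f hf lam hlam => ?_⟩
  have hsub : {x | ENNReal.ofReal lam < sqFnD j f x ^ ((1 : ℝ) / 2)} ⊆
      ⋃ N : ℕ, {x | ENNReal.ofReal (lam ^ 2) ≤ sqPartial f (2 * N) (-N) x} := by
    refine Subset.trans (fun x hx => ?_) (superlevel_tsum_sqTerm_subset f _)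
    refine lt_of_lt_of_le ?_ (sqFnD_le_tsum_sqTerm j f x)
    have h := ENNReal.rpow_lt_rpow (show ENNReal.ofReal lam < _ from hx) (zero_lt_two' ℝ)
    rw [← ENNReal.rpow_mul, ENNReal.rpow_two, ← ENNReal.ofReal_pow hlam.le] at h
    simpa using h
  have hI : ∫⁻ x, ‖f x‖ₑ = ENNReal.ofReal (∫ x, |f x|) :=
    (ofReal_integral_norm_eq_lintegral_enorm hf).symm
  have hI0 : 0 ≤ ∫ x, |f x| := integral_nonneg fun _ => abs_nonneg _
  calc ENNReal.ofReal lam * volume {x | ENNReal.ofReal lam < sqFnD j f x ^ ((1 : ℝ) / 2)}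
      ≤ ENNReal.ofReal lam *
          volume (⋃ N : ℕ, {x | ENNReal.ofReal (lam ^ 2) ≤ sqPartial f (2 * N) (-N) x}) := by
        gcongr
    _ = ⨆ N : ℕ, ENNReal.ofReal lam *
          volume {x | ENNReal.ofReal (lam ^ 2) ≤ sqPartial f (2 * N) (-N) x} := by
        rw [(monotone_superlevel_sqPartial f _).measure_iUnion, ENNReal.mul_iSup]
    _ ≤ ENNReal.ofReal (1 + 2 ^ d) * ∫⁻ x, ‖f x‖ₑ :=
        iSup_le fun N => weak_type_sqPartial hf hlam _ _
    _ = ENNReal.ofReal ((1 + 2 ^ d) * ∫ x, |f x|) := by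
        rw [hI, ENNReal.ofReal_mul (by positivity)]
    _ ≤ ENNReal.ofReal ((1 + 2 ^ d) * (1 + j) * ∫ x, |f x|) := by
        refine ENNReal.ofReal_le_ofReal (mul_le_mul_of_nonneg_right ?_ hI0)
        exact le_mul_of_one_le_right (by positivity) (by simp)
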